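/- Let T be a symmetric fourth-order tensor on ℝ^m such that T u²v² ≤ 0 for all u, v ∈ ℝ^m. Then for all x, y, z, w ∈ ℝ^m, 4 T x y z w ≥ T x²z² + T x²w² + T y²z² + T y²w². -/

import Mathlib

open Finset

noncomputable section

/-- The quadrilinear form associated to a fourth-order tensor on `ℝ^m`. -/
def tmul {m : ℕ} (T : Fin m → Fin m → Fin m → Fin m → ℝ)
    (a b c d : EuclideanSpace ℝ (Fin m)) : ℝ :=
  ∑ i, ∑ j, ∑ k, ∑ l, T i j k l * a i * b j * c k * d l

/-- A fourth-order tensor is symmetric if its entries are invariant under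
every permutation of the four indices. -/
def IsSymm4 {m : ℕ} (T : Fin m → Fin m → Fin m → Fin m → ℝ) : Prop :=
  ∀ (σ : Equiv.Perm (Fin 4)) (v : Fin 4 → Fin m),
    T (v (σ 0)) (v (σ 1)) (v (σ 2)) (v (σ 3)) = T (v 0) (v 1) (v 2) (v 3)

theorem tmul_add1 {m : ℕ} (T : Fin m → Fin m → Fin m → Fin m → ℝ)
    (a a' b c d : EuclideanSpace ℝ (Fin m)) :
    tmul T (a + a') b c d = tmul T a b c d + tmul T a' b c d := by
  simp only [tmul, ← Finset.sum_add_distrib, PiLp.add_apply]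
  refine sum_congr rfl fun i _ => sum_congr rfl fun j _ => sum_congr rfl fun k _ =>
    sum_congr rfl fun l _ => by ring

theorem tmul_smul1 {m : ℕ} (T : Fin m → Fin m → Fin m → Fin m → ℝ)
    (a b c d : EuclideanSpace ℝ (Fin m)) :
    tmul T (-a) b c d = - tmul T a b c d := by
  simp only [tmul, ← Finset.sum_neg_distrib, PiLp.neg_apply]
  refine sum_congr rfl fun i _ => sum_congr rfl fun j _ => sum_congr rfl fun k _ =>
    sum_congr rfl fun l _ => by ring

theorem tmul_swap12 {m : ℕ} (T : Fin m → Fin m → Fin m → Fin m → ℝ) (hT : IsSymm4 T)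
    (a b c d : EuclideanSpace ℝ (Fin m)) : tmul T a b c d = tmul T b a c d := by
  unfold tmul
  rw [Finset.sum_comm]
  refine sum_congr rfl fun i _ => sum_congr rfl fun j _ => sum_congr rfl fun k _ =>
    sum_congr rfl fun l _ => ?_
  have h : T j i k l = T i j k l := hT (Equiv.swap 0 1) ![i, j, k, l]
  rw [h]; ring

theorem tmul_swap1324 {m : ℕ} (T : Fin m → Fin m → Fin m → Fin m → ℝ) (hT : IsSymm4 T)
    (a b c d : EuclideanSpace ℝ (Fin m)) : tmul T a b c d = tmul T c d a b := by
  have e : ∀ a b c d : EuclideanSpace ℝ (Fin m), tmul T a b c d =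
      ∑ p : Fin m × Fin m, ∑ q : Fin m × Fin m,
        T p.1 p.2 q.1 q.2 * a p.1 * b p.2 * c q.1 * d q.2 := by
    intro a b c d
    simp only [tmul, Fintype.sum_prod_type]
  rw [e, e, Finset.sum_comm]
  refine sum_congr rfl fun p _ => sum_congr rfl fun q _ => ?_
  have h : T q.1 q.2 p.1 p.2 = T p.1 p.2 q.1 q.2 :=
    (hT (Equiv.swap 0 2) ![p.1, q.2, q.1, p.2] :
      T q.1 q.2 p.1 p.2 = T p.1 q.2 q.1 p.2).trans
      (hT (Equiv.swap 1 3) ![p.1, p.2, q.1, q.2] :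
      T p.1 q.2 q.1 p.2 = T p.1 p.2 q.1 q.2)
  rw [h]; ring

theorem stmt3 {m : ℕ} (T : Fin m → Fin m → Fin m → Fin m → ℝ) (hT : IsSymm4 T)
    (hneg : ∀ u v : EuclideanSpace ℝ (Fin m), tmul T u u v v ≤ 0)
    (x y z w : EuclideanSpace ℝ (Fin m)) :
    4 * tmul T x y z w
      ≥ tmul T x x z z + tmul T x x w w + tmul T y y z z + tmul T y y w w := by
  have s1 := tmul_swap12 T hT
  have s2 := tmul_swap1324 T hT
  have a1 := tmul_add1 T
  have n1 := tmul_smul1 T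
  have a2 : ∀ a b b' c d, tmul T a (b + b') c d = tmul T a b c d + tmul T a b' c d := by
    intro a b b' c d
    rw [s1, a1, s1 b, s1 b']
  have n2 : ∀ a b c d, tmul T a (-b) c d = - tmul T a b c d := by
    intro a b c d
    rw [s1, n1, s1 b]
  have a3 : ∀ a b c c' d, tmul T a b (c + c') d = tmul T a b c d + tmul T a b c' d := by
    intro a b c c' d
    rw [s2, a1, s2 c, s2 c']
  have n3 : ∀ a b c d, tmul T a b (-c) d = - tmul T a b c d := by
    intro a b c d
    rw [s2, n1, s2 c]
  have a4 : ∀ a b c d d', tmul T a b c (d + d') = tmul T a b c d + tmul T a b c d' := by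
    intro a b c d d'
    rw [s2, a2, s2 c, s2 c]
  have n4 : ∀ a b c d, tmul T a b c (-d) = - tmul T a b c d := by
    intro a b c d
    rw [s2, n2, s2 c]
  have h1 := hneg (x + y) (z + -w)
  have h2 := hneg (x + -y) (z + w)
  simp only [a1, a2, a3, a4, n1, n2, n3, n4] at h1 h2
  have e1 := s1 y x z w
  have e2 : tmul T x y w z = tmul T x y z w := by rw [s2, s1, s2]
  have e3 : tmul T y x w z = tmul T x y z w := by rw [s1, e2]
  linarith

end
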